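/- There exist finite simple graphs G and H that are not isomorphic but satisfy w⁽ʳ⁾(G) = w⁽ʳ⁾(H) for every natural number r. (In particular, the full walk-refinement hierarchy, and hence every spectral invariant (spec, p⁽ʳ⁾), fails to distinguish some pair of non-isomorphic graphs.) -/

import Mathlib

/-- The walk count `w_k(x,y)`: the number of walks of length `k` from `x` to `y`,
i.e. the `(x,y)` entry of the `k`-th power of the adjacency matrix. -/
def walkFun {V : Type*} [Fintype V] [DecidableEq V]
    (G : SimpleGraph V) [DecidableRel G.Adj] (x y : V) : ℕ → ℕ :=
  fun k => (G.adjMatrix ℕ ^ k) x y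

/-- The type of the walk-refinement color of a vertex after `r` rounds. -/
def WT : ℕ → Type
  | 0 => ℕ → ℕ
  | r + 1 => WT r × Multiset ((ℕ → ℕ) × WT r)

/-- The walk-refinement coloring: `ω_0(x) = (k ↦ w_k(x,x))` and
`ω_{r+1}(x) = (ω_r(x), ⦃((k ↦ w_k(x,y)), ω_r(y)) : y ∈ V⦄)`. -/
def omegaC {V : Type*} [Fintype V] [DecidableEq V]
    (G : SimpleGraph V) [DecidableRel G.Adj] : (r : ℕ) → V → WT r
  | 0, x => walkFun G x x
  | r + 1, x =>
    (omegaC G r x,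
      (Finset.univ : Finset V).val.map fun y => (walkFun G x y, omegaC G r y))

/-- `w⁽ʳ⁾(G)`: the multiset, over vertices `x`, of `ω_r(x)`. -/
def wR {V : Type*} [Fintype V] [DecidableEq V]
    (G : SimpleGraph V) [DecidableRel G.Adj] (r : ℕ) : Multiset (WT r) :=
  (Finset.univ : Finset V).val.map (omegaC G r)

/-- The 4×4 rook graph on `Fin 16`, as a Boolean relation. -/
def rookB (x y : Fin 16) : Bool :=
  x.val != y.val && (x.val / 4 == y.val / 4 || x.val % 4 == y.val % 4)

/-- The Shrikhande graph on `Fin 16`: Cayley graph of `ℤ/4 × ℤ/4` with connection set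
`±(1,0), ±(0,1), ±(1,1)`. -/
def shriB (x y : Fin 16) : Bool :=
  let a := (x.val / 4 + 4 - y.val / 4) % 4
  let b := (x.val % 4 + 4 - y.val % 4) % 4
  (b == 0 && (a == 1 || a == 3)) || (a == 0 && (b == 1 || b == 3)) ||
    (a == 1 && b == 1) || (a == 3 && b == 3)

/-- The rook graph. -/
def rookG : SimpleGraph (Fin 16) where
  Adj x y := rookB x y = true
  symm := ⟨by decide +kernel⟩
  loopless := ⟨by decide +kernel⟩

/-- The Shrikhande graph. -/
def shriG : SimpleGraph (Fin 16) where
  Adj x y := shriB x y = true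
  symm := ⟨by decide +kernel⟩
  loopless := ⟨by decide +kernel⟩

instance rookDec : DecidableRel rookG.Adj := fun x y => inferInstanceAs (Decidable (rookB x y = true))
instance shriDec : DecidableRel shriG.Adj := fun x y => inferInstanceAs (Decidable (shriB x y = true))

/-- Coefficients of the powers of the adjacency matrix in terms of `I`, `J`, `A`. -/
def coefs : ℕ → ℕ × ℕ × ℕ
  | 0 => (1, 0, 0)
  | k + 1 => (4 * (coefs k).2.2, 6 * (coefs k).2.1 + 2 * (coefs k).2.2, (coefs k).1)

/-- The walk function as a function of the relation type of a pair. -/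
def wtype (p : Bool × Bool) : ℕ → ℕ := fun k =>
  (coefs k).1 * p.1.toNat + (coefs k).2.1 + (coefs k).2.2 * p.2.toNat

/-- The multiset of relation types seen from a vertex. -/
def profile : Multiset (Bool × Bool) :=
  Multiset.replicate 1 (true, false) + Multiset.replicate 6 (false, true) +
    Multiset.replicate 9 (false, false)

/-- The common colour. -/
def common : (r : ℕ) → WT r
  | 0 => wtype (true, false)
  | r + 1 => (common r, profile.map fun p => (wtype p, common r))

section
variable (G : SimpleGraph (Fin 16)) [DecidableRel G.Adj]

theorem walkFun_eq (h2 : ∀ x y, ∑ z, (decide (G.Adj x z)).toNat * (decide (G.Adj z y)).toNat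
      = 4 * (decide (x = y)).toNat + 2)
    (h1 : ∀ y, ∑ z, (decide (G.Adj z y)).toNat = 6) (x y : Fin 16) :
    walkFun G x y = wtype (decide (x = y), decide (G.Adj x y)) := by
  have hA : ∀ a b, G.adjMatrix ℕ a b = (decide (G.Adj a b)).toNat := by
    intro a b
    by_cases h : G.Adj a b <;> simp [SimpleGraph.adjMatrix_apply, h]
  funext k
  induction k generalizing y with
  | zero => by_cases h : x = y <;> simp [walkFun, wtype, coefs, h]
  | succ k ih =>
    have e : walkFun G x y (k + 1) = ∑ z, walkFun G x z k * (decide (G.Adj z y)).toNat := by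
      simp only [walkFun, pow_succ, Matrix.mul_apply, hA]
    have e0 : ∑ z, (decide (x = z)).toNat * (decide (G.Adj z y)).toNat
        = (decide (G.Adj x y)).toNat := by
      rw [Finset.sum_eq_single x]
      · simp
      · intro b _ hb
        simp [Ne.symm hb]
      · simp
    rw [e]
    simp only [ih, wtype, coefs, add_mul, Finset.sum_add_distrib, mul_assoc, ← Finset.mul_sum,
      e0, h1, h2]
    ring

theorem omegaC_eq (h2 : ∀ x y, ∑ z, (decide (G.Adj x z)).toNat * (decide (G.Adj z y)).toNat
      = 4 * (decide (x = y)).toNat + 2)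
    (h1 : ∀ y, ∑ z, (decide (G.Adj z y)).toNat = 6)
    (hp : ∀ x, (Finset.univ : Finset (Fin 16)).val.map
      (fun y => (decide (x = y), decide (G.Adj x y))) = profile) (r : ℕ) (x : Fin 16) :
    omegaC G r x = common r := by
  induction r generalizing x with
  | zero =>
    change walkFun G x x = wtype (true, false)
    rw [walkFun_eq G h2 h1]
    simp
  | succ r ih =>
    change (omegaC G r x, _) = (common r, _)
    rw [ih]
    congr 1
    rw [← hp x, Multiset.map_map]
    refine Multiset.map_congr rfl fun y _ => ?_
    simp only [Function.comp, ih, walkFun_eq G h2 h1]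

end

theorem rook_omega (r : ℕ) : omegaC rookG r = fun _ => common r := by
  funext x
  exact omegaC_eq rookG (by decide +kernel) (by decide +kernel) (by decide +kernel) r x

theorem shri_omega (r : ℕ) : omegaC shriG r = fun _ => common r := by
  funext x
  exact omegaC_eq shriG (by decide +kernel) (by decide +kernel) (by decide +kernel) r x

theorem shri_no_clique : ∀ a b, shriG.Adj a b → ∀ c, shriG.Adj a c → shriG.Adj b c →
    ∀ d, shriG.Adj a d → shriG.Adj b d → ¬ shriG.Adj c d := by
  decide +kernel

/-- There exist non-isomorphic finite simple graphs `G` and `H`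
with `w⁽ʳ⁾(G) = w⁽ʳ⁾(H)` for every `r`: the full walk-refinement hierarchy fails
to distinguish some pair of non-isomorphic graphs. -/
theorem exists_nonisomorphic_wR_equivalent :
    ∃ (n m : ℕ) (G : SimpleGraph (Fin n)) (H : SimpleGraph (Fin m))
      (dG : DecidableRel G.Adj) (dH : DecidableRel H.Adj),
      ¬ Nonempty (G ≃g H) ∧
        ∀ r : ℕ, @wR (Fin n) _ _ G dG r = @wR (Fin m) _ _ H dH r := by
  refine ⟨16, 16, rookG, shriG, rookDec, shriDec, ?_, ?_⟩
  · rintro ⟨f⟩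
    have h : ∀ a b, rookG.Adj a b → shriG.Adj (f a) (f b) := fun a b h => f.map_adj_iff.mpr h
    exact shri_no_clique (f 0) (f 1) (h _ _ (by decide +kernel)) (f 2) (h _ _ (by decide +kernel))
      (h _ _ (by decide +kernel)) (f 3) (h _ _ (by decide +kernel)) (h _ _ (by decide +kernel))
      (h _ _ (by decide +kernel))
  · intro r
    simp only [wR, rook_omega, shri_omega]
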